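/- Let ψ ∈ H_A ⊗ H_B with reduced density operator support Ĥ_A ⊆ H_A, and let A : Ĥ_A → Z be a linear map. Then the range of A equals the support of the reduced density operator on Z of the (unnormalized) vector (A ⊗ I_B)ψ. -/

import Mathlib

open Matrix

open scoped ComplexOrder in
/-- The range of `M * Mᴴ` is the range of `M`. -/
theorem range_self_mul_conjTranspose_aux {m n : ℕ} (M : Matrix (Fin m) (Fin n) ℂ) :
    LinearMap.range (Matrix.mulVecLin (M * Mᴴ)) = LinearMap.range (Matrix.mulVecLin M) := by
  apply Submodule.eq_of_le_of_finrank_eq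
  · rw [Matrix.mulVecLin_mul]
    exact LinearMap.range_comp_le_range _ _
  · exact Matrix.rank_self_mul_conjTranspose M

/-- With a pure state `ψ ∈ H_A ⊗ H_B` represented by its coefficient matrix
`M : Matrix (Fin m) (Fin n) ℂ` (reduced density operator on `H_A` equal to `M * Mᴴ`, support
`Ĥ_A = range (M * Mᴴ)`), and a linear map `A : Ĥ_A → Z` (represented by a matrix on `H_A`;
its values outside `Ĥ_A` do not affect the claim), the image `A(Ĥ_A)` equals the support of
the reduced density operator on `Z` of the (unnormalized) vector `φ = (A ⊗ I)ψ`, whose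
coefficient matrix is `A * M`, i.e. `range ((A*M) * (A*M)ᴴ)`. -/
theorem stmt4 {m n z : ℕ} (M : Matrix (Fin m) (Fin n) ℂ)
    (hunit : ∑ i, ∑ j, ‖M i j‖ ^ 2 = 1)
    (A : Matrix (Fin z) (Fin m) ℂ) :
    Submodule.map (Matrix.mulVecLin A)
        (LinearMap.range (Matrix.mulVecLin (M * Mᴴ)))
      = LinearMap.range (Matrix.mulVecLin ((A * M) * (A * M)ᴴ)) := by
  rw [range_self_mul_conjTranspose_aux, range_self_mul_conjTranspose_aux, Matrix.mulVecLin_mul,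
    LinearMap.range_comp]
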